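/- arXiv:2004.02444 — 2 statements merged into one kernel-verified Lean document; each statement's English description precedes it below -/
import Mathlib

section
/- For any μ_0 ∈ dom(ℓ), the sequence of ML-EM iterates (μ_k) has at least one weak-* cluster point in M_+(K), and every weak-* cluster point μ̄ of (μ_k) belongs to dom(ℓ) and is a fixed point of the ML-EM map: T(μ̄) = μ̄, i.e. μ̄ equals the measure with density x ↦ (1/f(x))·Σ_{γ∈Γ} γ(x)/⟨μ̄, γ⟩ with respect to μ̄. -/
open MeasureTheory Filter

/-- The topological support of a Borel measure: the set of points all of whose open
neighbourhoods have positive measure. -/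
def msupport {K : Type*} [TopologicalSpace K] [MeasurableSpace K] (μ : Measure K) : Set K :=
  {x | ∀ U : Set K, x ∈ U → IsOpen U → μ U ≠ 0}

-- The negative log-likelihood `ℓ(μ) = ⟨μ, f⟩ - ∑_{γ ∈ Γ} log ⟨μ, γ⟩`, with value `+∞`
-- outside of its domain `dom(ℓ) = {μ : ⟨μ, γ⟩ > 0 for all γ ∈ Γ}`.
open Classical in
noncomputable def loss {K : Type*} [TopologicalSpace K] [MeasurableSpace K]
    (f : C(K, ℝ)) (Γ : Finset C(K, ℝ)) (μ : Measure K) : EReal :=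
  if ∀ γ ∈ Γ, 0 < ∫ x, γ x ∂μ then
    (((∫ x, f x ∂μ) - ∑ γ ∈ Γ, Real.log (∫ x, γ x ∂μ) : ℝ) : EReal)
  else ⊤

/-- The real-valued negative log-likelihood, for measures in the domain. -/
noncomputable def lossR {K : Type*} [TopologicalSpace K] [MeasurableSpace K]
    (f : C(K, ℝ)) (Γ : Finset C(K, ℝ)) (μ : Measure K) : ℝ :=
  (∫ x, f x ∂μ) - ∑ γ ∈ Γ, Real.log (∫ x, γ x ∂μ)

/-- The ML-EM map `T`, sending `μ` to the measure with density
`x ↦ (1/f(x)) ∑_{γ∈Γ} γ(x)/⟨μ,γ⟩` with respect to `μ`. -/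
noncomputable def mlem {K : Type*} [TopologicalSpace K] [MeasurableSpace K]
    (f : C(K, ℝ)) (Γ : Finset C(K, ℝ)) (μ : Measure K) : Measure K :=
  μ.withDensity (fun x => ENNReal.ofReal ((f x)⁻¹ * ∑ γ ∈ Γ, γ x / (∫ y, γ y ∂μ)))

/-- Kullback–Leibler divergence `D(μ‖ν) = ∫ log(dμ/dν) dμ`. -/
noncomputable def KL {K : Type*} [MeasurableSpace K] (μ ν : Measure K) : ℝ :=
  ∫ x, Real.log ((μ.rnDeriv ν x).toReal) ∂μ

/-- The probability measure `ν_γ(μ) = (γ/⟨μ,γ⟩)·μ`. -/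
noncomputable def nug {K : Type*} [TopologicalSpace K] [MeasurableSpace K]
    (γ : C(K, ℝ)) (μ : Measure K) : Measure K :=
  μ.withDensity (fun x => ENNReal.ofReal (γ x / (∫ y, γ y ∂μ)))

/-- The measure `f·ν`, with density `f` with respect to `ν`. -/
noncomputable def fdot {K : Type*} [TopologicalSpace K] [MeasurableSpace K]
    (f : C(K, ℝ)) (ν : Measure K) : Measure K :=
  ν.withDensity (fun x => ENNReal.ofReal (f x))

/-- The surrogate `Q_k(μ) = ℓ(μ) + ∑_{γ∈Γ} D(ν_γ(μ_k) ‖ ν_γ(μ))`. -/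
noncomputable def Qsur {K : Type*} [TopologicalSpace K] [MeasurableSpace K]
    (f : C(K, ℝ)) (Γ : Finset C(K, ℝ)) (μk μ : Measure K) : ℝ :=
  lossR f Γ μ + ∑ γ ∈ Γ, KL (nug γ μk) (nug γ μ)

open TopologicalSpace in
/-- A sequence of finite measures of bounded mass on a compact metric space has a weakly
convergent subsequence. -/
lemma exists_subseq_tendsto_integral {K : Type*} [MetricSpace K] [CompactSpace K] [Nonempty K]
    [MeasurableSpace K] [BorelSpace K] (μ : ℕ → Measure K) [∀ k, IsFiniteMeasure (μ k)]
    (C : ℝ) (hC : ∀ k, (μ k).real Set.univ ≤ C) :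
    ∃ ν : Measure K, IsFiniteMeasure ν ∧ ∃ φ : ℕ → ℕ, StrictMono φ ∧ ∀ g : C(K, ℝ),
      Tendsto (fun j => ∫ x, g x ∂(μ (φ j))) atTop (nhds (∫ x, g x ∂ν)) := by
  let m : ℕ → FiniteMeasure K := fun k => ⟨μ k, inferInstance⟩
  obtain ⟨p, φ, hφ, hp⟩ := CompactSpace.tendsto_subseq
    (fun k => ((⟨(μ k).real Set.univ, measureReal_nonneg, hC k⟩ : Set.Icc 0 C),
      (m k).normalize))
  rw [nhds_prod_eq, tendsto_prod_iff'] at hp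
  have hmass : Tendsto (fun j => (μ (φ j)).real Set.univ) atTop (nhds (p.1 : ℝ)) :=
    (continuous_subtype_val.tendsto _).comp hp.1
  have hint (k : ℕ) (g : C(K, ℝ)) :
      ∫ x, g x ∂(μ k) = (μ k).real Set.univ * ∫ x, g x ∂((m k).normalize : Measure K) := by
    have h := congrArg (fun ν : FiniteMeasure K => (ν : Measure K))
      (m k).self_eq_mass_smul_normalize
    change μ k = (m k).mass • ((m k).normalize : Measure K) at h
    conv_lhs => rw [h, integral_smul_nnreal_measure]
    rfl
  refine ⟨NNReal.mk p.1 p.1.2.1 • (p.2 : Measure K), inferInstance, φ, hφ, fun g => ?_⟩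
  rw [integral_smul_nnreal_measure]
  simp_rw [hint]
  have hnorm := ProbabilityMeasure.tendsto_iff_forall_integral_tendsto.1 hp.2
    (BoundedContinuousFunction.mkOfCompact g)
  exact hmass.mul hnorm

lemma ContinuousMap.integrable_of_compactSpace {K : Type*} [TopologicalSpace K] [CompactSpace K]
    [MeasurableSpace K] [OpensMeasurableSpace K] (μ : Measure K) [IsFiniteMeasure μ]
    (g : C(K, ℝ)) : Integrable (fun x => g x) μ :=
  (BoundedContinuousFunction.mkOfCompact g).integrable μ

/-- Weak convergence of measures passes to uniformly convergent integrands. -/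
lemma tendsto_integral_of_tendsto_continuousMap {K : Type*} [TopologicalSpace K] [CompactSpace K]
    [MeasurableSpace K] [OpensMeasurableSpace K] (μ : ℕ → Measure K)
    [∀ k, IsFiniteMeasure (μ k)] (ν : Measure K)
    (hμ : ∀ g : C(K, ℝ), Tendsto (fun j => ∫ x, g x ∂(μ j)) atTop (nhds (∫ x, g x ∂ν)))
    (g : ℕ → C(K, ℝ)) (g' : C(K, ℝ)) (hg : Tendsto g atTop (nhds g')) :
    Tendsto (fun j => ∫ x, g j x ∂(μ j)) atTop (nhds (∫ x, g' x ∂ν)) := by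
  have hdiff : Tendsto (fun j => ∫ x, (g j - g') x ∂(μ j)) atTop (nhds 0) := by
    refine squeeze_zero_norm (a := fun j => ‖g j - g'‖ * (μ j).real Set.univ)
      (fun j => norm_integral_le_of_norm_le_const (ae_of_all _ (g j - g').norm_coe_le_norm)) ?_
    have hmass : Tendsto (fun j => (μ j).real Set.univ) atTop (nhds (ν.real Set.univ)) := by
      simpa using hμ 1
    simpa using (tendsto_iff_norm_sub_tendsto_zero.1 hg).mul hmass
  have h := hdiff.add (hμ g')
  rw [zero_add] at h
  refine h.congr fun j => ?_
  rw [← integral_add ((g j - g').integrable_of_compactSpace _) (g'.integrable_of_compactSpace _)]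
  simp

/-- The density `x ↦ (1/f(x)) ∑_{γ∈Γ} γ(x)/a_γ` as a continuous map. -/
noncomputable def emFactor {K : Type*} [TopologicalSpace K] (f : C(K, ℝ)) (hf : ∀ x, f x ≠ 0)
    (Γ : Finset C(K, ℝ)) (a : C(K, ℝ) → ℝ) : C(K, ℝ) :=
  (⟨fun x => (f x)⁻¹, f.continuous.inv₀ hf⟩ : C(K, ℝ)) * ∑ γ ∈ Γ, (a γ)⁻¹ • γ

lemma emFactor_apply {K : Type*} [TopologicalSpace K] (f : C(K, ℝ)) (hf : ∀ x, f x ≠ 0)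
    (Γ : Finset C(K, ℝ)) (a : C(K, ℝ) → ℝ) (x : K) :
    emFactor f hf Γ a x = (f x)⁻¹ * ∑ γ ∈ Γ, γ x / a γ := by
  simp [emFactor, div_eq_inv_mul]

lemma mul_emFactor_apply {K : Type*} [TopologicalSpace K] (f : C(K, ℝ)) (hf : ∀ x, f x ≠ 0)
    (Γ : Finset C(K, ℝ)) (a : C(K, ℝ) → ℝ) (x : K) :
    f x * emFactor f hf Γ a x = ∑ γ ∈ Γ, γ x / a γ := by
  rw [emFactor_apply, mul_inv_cancel_left₀ (hf x)]

lemma emFactor_nonneg {K : Type*} [TopologicalSpace K] (f : C(K, ℝ)) (hf : ∀ x, 0 < f x)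
    (Γ : Finset C(K, ℝ)) (hΓ : ∀ γ ∈ Γ, ∀ x, 0 ≤ γ x) (a : C(K, ℝ) → ℝ)
    (ha : ∀ γ ∈ Γ, 0 < a γ) (x : K) : 0 ≤ emFactor f (fun x => (hf x).ne') Γ a x := by
  rw [emFactor_apply]
  exact mul_nonneg (inv_nonneg.2 (hf x).le)
    (Finset.sum_nonneg fun γ hγ => div_nonneg (hΓ γ hγ x) (ha γ hγ).le)

lemma emFactor_pos {K : Type*} [TopologicalSpace K] (f : C(K, ℝ)) (hf : ∀ x, 0 < f x)
    (Γ : Finset C(K, ℝ)) (hΓ : ∀ γ ∈ Γ, ∀ x, 0 ≤ γ x) (a : C(K, ℝ) → ℝ)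
    (ha : ∀ γ ∈ Γ, 0 < a γ) (x : K) {γ : C(K, ℝ)} (hγ : γ ∈ Γ) (hx : 0 < γ x) :
    0 < emFactor f (fun x => (hf x).ne') Γ a x := by
  rw [emFactor_apply]
  exact mul_pos (inv_pos.2 (hf x))
    (Finset.sum_pos' (fun γ hγ => div_nonneg (hΓ γ hγ x) (ha γ hγ).le)
      ⟨γ, hγ, div_pos hx (ha γ hγ)⟩)

lemma tendsto_emFactor {K : Type*} [TopologicalSpace K] [CompactSpace K] (f : C(K, ℝ))
    (hf : ∀ x, f x ≠ 0) (Γ : Finset C(K, ℝ)) (a : ℕ → C(K, ℝ) → ℝ) (b : C(K, ℝ) → ℝ)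
    (hb : ∀ γ ∈ Γ, b γ ≠ 0) (hab : ∀ γ ∈ Γ, Tendsto (fun j => a j γ) atTop (nhds (b γ))) :
    Tendsto (fun j => emFactor f hf Γ (a j)) atTop (nhds (emFactor f hf Γ b)) :=
  (tendsto_finsetSum _ fun γ hγ => ((hab γ hγ).inv₀ (hb γ hγ)).smul_const γ).const_mul _

lemma mlem_eq_withDensity_emFactor {K : Type*} [TopologicalSpace K] [MeasurableSpace K]
    (f : C(K, ℝ)) (hf : ∀ x, f x ≠ 0) (Γ : Finset C(K, ℝ)) (μ : Measure K) :
    mlem f Γ μ = μ.withDensity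
      (fun x => ENNReal.ofReal (emFactor f hf Γ (fun γ => ∫ y, γ y ∂μ) x)) := by
  simp_rw [emFactor_apply]
  rfl

lemma isFiniteMeasure_mlem {K : Type*} [TopologicalSpace K] [CompactSpace K] [MeasurableSpace K]
    [OpensMeasurableSpace K] (f : C(K, ℝ)) (hf : ∀ x, f x ≠ 0) (Γ : Finset C(K, ℝ))
    (μ : Measure K) [IsFiniteMeasure μ] : IsFiniteMeasure (mlem f Γ μ) := by
  rw [mlem_eq_withDensity_emFactor f hf]
  exact isFiniteMeasure_withDensity_ofReal
    (ContinuousMap.integrable_of_compactSpace μ (emFactor f hf Γ _)).2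

lemma integral_mlem {K : Type*} [TopologicalSpace K] [CompactSpace K] [MeasurableSpace K]
    [OpensMeasurableSpace K] (f : C(K, ℝ)) (hf : ∀ x, 0 < f x) (Γ : Finset C(K, ℝ))
    (hΓ : ∀ γ ∈ Γ, ∀ x, 0 ≤ γ x) (μ : Measure K) (hμ : ∀ γ ∈ Γ, 0 < ∫ x, γ x ∂μ) (g : K → ℝ) :
    ∫ x, g x ∂(mlem f Γ μ) =
      ∫ x, emFactor f (fun x => (hf x).ne') Γ (fun γ => ∫ y, γ y ∂μ) x * g x ∂μ := by
  rw [mlem_eq_withDensity_emFactor f (fun x => (hf x).ne'),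
    integral_withDensity_eq_integral_toReal_smul
      (ContinuousMap.continuous _).measurable.ennreal_ofReal (by simp)]
  refine integral_congr_ae (ae_of_all _ fun x => ?_)
  simp only [smul_eq_mul, ENNReal.toReal_ofReal (emFactor_nonneg f hf Γ hΓ _ hμ x)]

lemma integral_self_mlem {K : Type*} [TopologicalSpace K] [CompactSpace K] [MeasurableSpace K]
    [OpensMeasurableSpace K] (f : C(K, ℝ)) (hf : ∀ x, 0 < f x) (Γ : Finset C(K, ℝ))
    (hΓ : ∀ γ ∈ Γ, ∀ x, 0 ≤ γ x) (μ : Measure K) [IsFiniteMeasure μ]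
    (hμ : ∀ γ ∈ Γ, 0 < ∫ x, γ x ∂μ) : ∫ x, f x ∂(mlem f Γ μ) = Γ.card := by
  rw [integral_mlem f hf Γ hΓ μ hμ]
  simp_rw [mul_comm _ (f _), mul_emFactor_apply]
  rw [integral_finsetSum _ fun γ _ => (γ.integrable_of_compactSpace μ).div_const _]
  simp_rw [integral_div]
  rw [Finset.sum_congr rfl fun γ hγ => div_self (hμ γ hγ).ne']
  simp

lemma integral_pos_mlem {K : Type*} [TopologicalSpace K] [CompactSpace K] [MeasurableSpace K]
    [OpensMeasurableSpace K] (f : C(K, ℝ)) (hf : ∀ x, 0 < f x) (Γ : Finset C(K, ℝ))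
    (hΓ : ∀ γ ∈ Γ, ∀ x, 0 ≤ γ x) (μ : Measure K) [IsFiniteMeasure μ]
    (hμ : ∀ γ ∈ Γ, 0 < ∫ x, γ x ∂μ) : ∀ γ ∈ Γ, 0 < ∫ x, γ x ∂(mlem f Γ μ) := by
  intro γ hγ
  rw [integral_mlem f hf Γ hΓ μ hμ]
  set h := emFactor f (fun x => (hf x).ne') Γ (fun γ => ∫ y, γ y ∂μ)
  have hnn (x : K) : 0 ≤ h x * γ x :=
    mul_nonneg (emFactor_nonneg f hf Γ hΓ _ hμ x) (hΓ γ hγ x)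
  refine (integral_nonneg hnn).lt_of_ne fun h0 => (hμ γ hγ).ne' ?_
  have hae := (integral_eq_zero_iff_of_nonneg hnn
    ((h * γ).integrable_of_compactSpace μ)).1 h0.symm
  refine integral_eq_zero_of_ae (hae.mono fun x hx => ?_)
  by_contra hne
  have hpos : 0 < γ x := (hΓ γ hγ x).lt_of_ne' hne
  exact (mul_pos (emFactor_pos f hf Γ hΓ _ hμ x hγ hpos) hpos).ne' hx

/-- One step of ML-EM decreases the loss by at least `∫ f · klFun h`, where `h` is the density of
the new iterate with respect to the old one. -/
lemma integral_mul_klFun_emFactor_le {K : Type*} [TopologicalSpace K] [CompactSpace K]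
    [MeasurableSpace K] [OpensMeasurableSpace K] (f : C(K, ℝ)) (hf : ∀ x, 0 < f x)
    (Γ : Finset C(K, ℝ)) (hΓ : ∀ γ ∈ Γ, ∀ x, 0 ≤ γ x) (μ : Measure K) [IsFiniteMeasure μ]
    (hμ : ∀ γ ∈ Γ, 0 < ∫ x, γ x ∂μ) (hcard : ∫ x, f x ∂μ = Γ.card) :
    ∫ x, f x * InformationTheory.klFun
        (emFactor f (fun x => (hf x).ne') Γ (fun γ => ∫ y, γ y ∂μ) x) ∂μ ≤
      ∑ γ ∈ Γ, Real.log (∫ x, γ x ∂(mlem f Γ μ)) - ∑ γ ∈ Γ, Real.log (∫ x, γ x ∂μ) := by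
  have hpos := integral_pos_mlem f hf Γ hΓ μ hμ
  have hb (γ : C(K, ℝ)) := integral_mlem f hf Γ hΓ μ hμ γ
  set a : C(K, ℝ) → ℝ := fun γ => ∫ x, γ x ∂μ
  set b : C(K, ℝ) → ℝ := fun γ => ∫ x, γ x ∂(mlem f Γ μ)
  set h := emFactor f (fun x => (hf x).ne') Γ a
  have key (γ : C(K, ℝ)) (hγ : γ ∈ Γ) (x : K) : γ x / a γ * Real.log (h x) ≤
      γ x / a γ * (Real.log (b γ) - Real.log (a γ) - 1) + h x * γ x / b γ := by
    rcases (hΓ γ hγ x).eq_or_lt with h0 | h0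
    · simp [← h0]
    have hx : 0 < h x := emFactor_pos f hf Γ hΓ _ hμ x hγ h0
    have haγ : 0 < a γ := hμ γ hγ
    have hbγ : 0 < b γ := hpos γ hγ
    have hlog := Real.log_le_sub_one_of_pos (div_pos (mul_pos hx haγ) hbγ)
    rw [Real.log_div (mul_pos hx haγ).ne' hbγ.ne', Real.log_mul hx.ne' haγ.ne'] at hlog
    calc γ x / a γ * Real.log (h x)
        ≤ γ x / a γ * (Real.log (b γ) - Real.log (a γ) - 1 + h x * a γ / b γ) := by
          gcongr
          linarith
      _ = _ := by
          field_simp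
  let F : C(K, ℝ) → C(K, ℝ) := fun γ =>
    ((a γ)⁻¹ * (Real.log (b γ) - Real.log (a γ) - 2)) • γ + (b γ)⁻¹ • (h * γ)
  have hF (γ : C(K, ℝ)) (hγ : γ ∈ Γ) :
      ∫ x, F γ x ∂μ = Real.log (b γ) - Real.log (a γ) - 1 := by
    have h1 : ∫ x, F γ x ∂μ =
        (a γ)⁻¹ * (Real.log (b γ) - Real.log (a γ) - 2) * a γ + (b γ)⁻¹ * b γ := by
      simp only [F, ContinuousMap.add_apply, ContinuousMap.smul_apply, smul_eq_mul]
      rw [integral_add ((γ.integrable_of_compactSpace μ).const_mul _)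
        (((h * γ).integrable_of_compactSpace μ).const_mul _), integral_const_mul,
        integral_const_mul]
      simp only [ContinuousMap.mul_apply]
      rw [← hb γ]
    have haγ : a γ ≠ 0 := (hμ γ hγ).ne'
    have hbγ : b γ ≠ 0 := (hpos γ hγ).ne'
    rw [h1]
    field_simp
    ring
  have hle (x : K) : f x * InformationTheory.klFun (h x) ≤ (f + ∑ γ ∈ Γ, F γ) x := by
    have hs : f x * h x = ∑ γ ∈ Γ, γ x / a γ := mul_emFactor_apply f _ Γ a x
    calc f x * InformationTheory.klFun (h x)
        = f x + (f x * h x * Real.log (h x) - f x * h x) := by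
          rw [InformationTheory.klFun_apply]
          ring
      _ = f x + ∑ γ ∈ Γ, (γ x / a γ * Real.log (h x) - γ x / a γ) := by
          rw [hs, Finset.sum_sub_distrib, Finset.sum_mul]
      _ ≤ f x + ∑ γ ∈ Γ, F γ x := by
          gcongr with γ hγ
          have := key γ hγ x
          simp only [F, ContinuousMap.add_apply, ContinuousMap.smul_apply, smul_eq_mul,
            ContinuousMap.mul_apply]
          rw [div_eq_inv_mul, div_eq_inv_mul] at this
          rw [div_eq_inv_mul]
          linarith
      _ = _ := by simp
  calc _ ≤ ∫ x, (f + ∑ γ ∈ Γ, F γ) x ∂μ := by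
        refine integral_mono ?_ (ContinuousMap.integrable_of_compactSpace μ _) hle
        exact (f * ContinuousMap.comp ⟨_, InformationTheory.continuous_klFun⟩
          h).integrable_of_compactSpace μ
    _ = Γ.card + ∑ γ ∈ Γ, (Real.log (b γ) - Real.log (a γ) - 1) := by
        simp only [ContinuousMap.add_apply, ContinuousMap.sum_apply]
        rw [integral_add (f.integrable_of_compactSpace μ) (integrable_finsetSum _
          fun γ _ => (F γ).integrable_of_compactSpace μ), hcard,
          integral_finsetSum _ fun γ _ => (F γ).integrable_of_compactSpace μ,
          Finset.sum_congr rfl hF]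
    _ = _ := by
        simp only [Finset.sum_sub_distrib, Finset.sum_const, nsmul_eq_mul, mul_one]
        ring

/-- Positive reals bounded above whose product is bounded below are bounded away from zero. -/
lemma exists_pos_forall_le_of_le_sum_log {ι : Type*} (s : Finset ι) (C L : ℝ) :
    ∃ δ > 0, ∀ a : ι → ℝ, (∀ i ∈ s, 0 < a i) → (∀ i ∈ s, a i ≤ C) →
      L ≤ ∑ i ∈ s, Real.log (a i) → ∀ i ∈ s, δ ≤ a i := by
  classical
  refine ⟨Real.exp (L - (s.card - 1 : ℕ) * Real.log C), Real.exp_pos _,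
    fun a ha haC hL i hi => ?_⟩
  rw [← Real.le_log_iff_exp_le (ha i hi)]
  have hrest : ∑ j ∈ s.erase i, Real.log (a j) ≤ (s.card - 1 : ℕ) * Real.log C := by
    rw [← Finset.card_erase_of_mem hi, ← nsmul_eq_mul]
    refine Finset.sum_le_card_nsmul _ _ _ fun j hj => ?_
    have hj := Finset.mem_of_mem_erase hj
    exact Real.log_le_log (ha j hj) (haC j hj)
  rw [← Finset.add_sum_erase s _ hi] at hL
  linarith

/-- Weak-* cluster points of ML-EM iterates exist and are fixed points of the ML-EM map. -/
theorem stmt14 {K : Type*} [MetricSpace K] [CompactSpace K] [Nonempty K]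
    [MeasurableSpace K] [BorelSpace K]
    (f : C(K, ℝ)) (c : ℝ) (hc : 0 < c) (hf : ∀ x : K, c ≤ f x)
    (Γ : Finset C(K, ℝ)) (hΓ : Γ.Nonempty) (hΓpos : ∀ γ ∈ Γ, ∀ x : K, 0 ≤ γ x)
    (μ0 : Measure K) [IsFiniteMeasure μ0] (hdom0 : ∀ γ ∈ Γ, 0 < ∫ x, γ x ∂μ0)
    (μseq : ℕ → Measure K) (h0 : μseq 0 = μ0)
    (hrec : ∀ k : ℕ, μseq (k + 1) = mlem f Γ (μseq k)) :
    (∃ μbar : Measure K, IsFiniteMeasure μbar ∧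
      ∃ φ : ℕ → ℕ, StrictMono φ ∧ ∀ g : C(K, ℝ),
        Tendsto (fun j => ∫ x, g x ∂(μseq (φ j))) atTop (nhds (∫ x, g x ∂μbar))) ∧
    ∀ μbar : Measure K, IsFiniteMeasure μbar →
      (∃ φ : ℕ → ℕ, StrictMono φ ∧ ∀ g : C(K, ℝ),
        Tendsto (fun j => ∫ x, g x ∂(μseq (φ j))) atTop (nhds (∫ x, g x ∂μbar))) →
      ((∀ γ ∈ Γ, 0 < ∫ x, γ x ∂μbar) ∧ mlem f Γ μbar = μbar) := by
  have hfpos (x : K) : 0 < f x := hc.trans_le (hf x)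
  have hiter (k : ℕ) : IsFiniteMeasure (μseq k) ∧ ∀ γ ∈ Γ, 0 < ∫ x, γ x ∂(μseq k) := by
    induction k with
    | zero => exact h0 ▸ ⟨inferInstance, hdom0⟩
    | succ k ih =>
      have := ih.1
      rw [hrec]
      exact ⟨isFiniteMeasure_mlem f (fun x => (hfpos x).ne') Γ _,
        integral_pos_mlem f hfpos Γ hΓpos _ ih.2⟩
  have hfin (k : ℕ) : IsFiniteMeasure (μseq k) := (hiter k).1
  have hdom (k : ℕ) := (hiter k).2
  have hcard (k : ℕ) : ∫ x, f x ∂(μseq (k + 1)) = Γ.card := by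
    rw [hrec]
    exact integral_self_mlem f hfpos Γ hΓpos _ (hdom k)
  have hmass (k : ℕ) : (μseq (k + 1)).real Set.univ ≤ Γ.card / c := by
    rw [le_div_iff₀ hc, ← hcard k]
    calc _ = ∫ _, c ∂(μseq (k + 1)) := by simp
      _ ≤ _ := integral_mono (integrable_const c) (f.integrable_of_compactSpace _) hf
  refine ⟨?_, fun μbar hμbar ⟨φ, hφ, hlim⟩ => ?_⟩
  · obtain ⟨ν, hν, φ, hφ, h⟩ :=
      exists_subseq_tendsto_integral (fun k => μseq (k + 1)) _ hmass
    exact ⟨ν, hν, fun j => φ j + 1, fun i j hij => Nat.succ_lt_succ (hφ hij), h⟩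
  have hbound (k : ℕ) (γ : C(K, ℝ)) (hγ : γ ∈ Γ) :
      ∫ x, γ x ∂(μseq (k + 1)) ≤ (∑ γ ∈ Γ, ‖γ‖) * (Γ.card / c) := by
    calc ∫ x, γ x ∂(μseq (k + 1)) ≤ ‖∫ x, γ x ∂(μseq (k + 1))‖ := Real.le_norm_self _
      _ ≤ ‖γ‖ * (μseq (k + 1)).real Set.univ :=
        norm_integral_le_of_norm_le_const (ae_of_all _ γ.norm_coe_le_norm)
      _ ≤ _ := by
        gcongr
        · exact Finset.single_le_sum (f := fun γ => ‖γ‖) (fun γ _ => norm_nonneg γ) hγ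
        · exact hmass k
  let L : ℕ → ℝ := fun k => ∑ γ ∈ Γ, Real.log (∫ x, γ x ∂(μseq (k + 1)))
  let h : ℕ → C(K, ℝ) := fun k =>
    emFactor f (fun x => (hfpos x).ne') Γ (fun γ => ∫ y, γ y ∂(μseq k))
  let kl : C(ℝ, ℝ) := ⟨_, InformationTheory.continuous_klFun⟩
  let D : ℕ → ℝ := fun k => ∫ x, (f * kl.comp (h k)) x ∂(μseq k)
  have hD_nonneg (k : ℕ) : 0 ≤ D k := integral_nonneg fun x => mul_nonneg (hfpos x).le
    (InformationTheory.klFun_nonneg (emFactor_nonneg f hfpos Γ hΓpos _ (hdom k) x))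
  have hD_le (k : ℕ) : D (k + 1) ≤ L (k + 1) - L k := by
    simp only [L]
    rw [hrec (k + 1)]
    exact integral_mul_klFun_emFactor_le f hfpos Γ hΓpos _ (hdom (k + 1)) (hcard k)
  have hL_mono : Monotone L := monotone_nat_of_le_succ fun k => by
    linarith [hD_nonneg (k + 1), hD_le k]
  have hL_bdd : BddAbove (Set.range L) := by
    refine ⟨∑ γ ∈ Γ, Real.log ((∑ γ ∈ Γ, ‖γ‖) * (Γ.card / c)), ?_⟩
    rintro _ ⟨k, rfl⟩
    exact Finset.sum_le_sum fun γ hγ => Real.log_le_log (hdom (k + 1) γ hγ) (hbound k γ hγ)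
  have hL_lim := tendsto_atTop_ciSup hL_mono hL_bdd
  have hD_lim : Tendsto D atTop (nhds 0) := by
    rw [← tendsto_add_atTop_iff_nat 1]
    refine squeeze_zero (fun k => hD_nonneg (k + 1)) hD_le ?_
    simpa using (hL_lim.comp (tendsto_add_atTop_nat 1)).sub hL_lim
  have hbar : ∀ γ ∈ Γ, 0 < ∫ x, γ x ∂μbar := by
    obtain ⟨δ, hδ, hle⟩ := exists_pos_forall_le_of_le_sum_log Γ
      ((∑ γ ∈ Γ, ‖γ‖) * (Γ.card / c)) (L 0)
    intro γ hγ
    refine hδ.trans_le (ge_of_tendsto (hlim γ) ?_)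
    filter_upwards [eventually_ge_atTop 1] with j hj
    obtain ⟨k, hk⟩ := Nat.exists_eq_add_of_le' (hj.trans (hφ.id_le j))
    rw [hk]
    exact hle _ (hdom (k + 1)) (hbound k) (hL_mono (Nat.zero_le k)) γ hγ
  refine ⟨hbar, ?_⟩
  set hb := emFactor f (fun x => (hfpos x).ne') Γ (fun γ => ∫ y, γ y ∂μbar) with hb_def
  have hh_lim : Tendsto (fun j => h (φ j)) atTop (nhds hb) :=
    tendsto_emFactor f _ Γ _ _ (fun γ hγ => (hbar γ hγ).ne') fun γ _ => hlim γ
  have hb_nonneg := emFactor_nonneg f hfpos Γ hΓpos _ hbar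
  have hzero : ∫ x, (f * kl.comp hb) x ∂μbar = 0 := by
    refine tendsto_nhds_unique ?_ (hD_lim.comp hφ.tendsto_atTop)
    exact tendsto_integral_of_tendsto_continuousMap (fun j => μseq (φ j)) μbar hlim
      (fun j => f * kl.comp (h (φ j))) _
      (((kl.continuous_postcomp.tendsto hb).comp hh_lim).const_mul f)
  have hae := (integral_eq_zero_iff_of_nonneg
    (fun x => mul_nonneg (hfpos x).le (InformationTheory.klFun_nonneg (hb_nonneg x)))
    ((f * kl.comp hb).integrable_of_compactSpace μbar)).1 hzero
  rw [mlem_eq_withDensity_emFactor f (fun x => (hfpos x).ne')]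
  conv_rhs => rw [← withDensity_one (μ := μbar)]
  refine withDensity_congr_ae (hae.mono fun x hx => ?_)
  have hkl : InformationTheory.klFun (hb x) = 0 := (mul_eq_zero.1 hx).resolve_left (hfpos x).ne'
  have h1 : hb x = 1 := (InformationTheory.klFun_eq_zero_iff (hb_nonneg x)).1 hkl
  simp [← hb_def, h1]
end

section
/- A measure μ̄ ∈ dom(ℓ) is a fixed point of the ML-EM map (T(μ̄) = μ̄) if and only if the measure with density ∇ℓ(μ̄) := f − Σ_{γ∈Γ} γ/⟨μ̄, γ⟩ with respect to μ̄ is the zero measure, which holds if and only if ∇ℓ(μ̄)(x) = 0 for every x in the topological support of μ̄. -/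
open MeasureTheory Filter

theorem msupport_eq_support {K : Type*} [TopologicalSpace K] [MeasurableSpace K]
    (μ : Measure K) : msupport μ = μ.support := by
  ext x
  rw [Measure.support_eq_forall_isOpen]
  simp [msupport, pos_iff_ne_zero]

/-- A continuous function vanishes almost everywhere iff it vanishes on the support. -/
theorem ae_eq_zero_iff_forall_mem_msupport {K : Type*} [TopologicalSpace K]
    [HereditarilyLindelofSpace K] [MeasurableSpace K] (μ : Measure K)
    {g : K → ℝ} (hg : Continuous g) :
    g =ᵐ[μ] 0 ↔ ∀ x ∈ msupport μ, g x = 0 := by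
  rw [msupport_eq_support]
  refine ⟨fun h => ?_, fun h => ?_⟩
  · exact fun x hx => Measure.support_subset_of_isClosed (isClosed_singleton.preimage hg) h hx
  · filter_upwards [Measure.support_mem_ae (μ := μ)] with x hx using h x hx

/-- The density `∇ℓ(μ)` is continuous. -/
theorem continuous_sub_sum_div_integral {K : Type*} [TopologicalSpace K] [MeasurableSpace K]
    (f : C(K, ℝ)) (Γ : Finset C(K, ℝ)) (μ : Measure K) :
    Continuous fun x => f x - ∑ γ ∈ Γ, γ x / (∫ y, γ y ∂μ) := by
  fun_prop

/-- Fixed points of the ML-EM map are the measures for which `∇ℓ(μ)` vanishes almost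
everywhere. -/
theorem mlem_eq_self_iff {K : Type*} [TopologicalSpace K] [MeasurableSpace K]
    [OpensMeasurableSpace K] (f : C(K, ℝ)) (hf : ∀ x, 0 < f x) (Γ : Finset C(K, ℝ))
    (μ : Measure K) [IsFiniteMeasure μ] :
    mlem f Γ μ = μ ↔ (fun x => f x - ∑ γ ∈ Γ, γ x / (∫ y, γ y ∂μ)) =ᵐ[μ] 0 := by
  have hm : Measurable fun x => ENNReal.ofReal ((f x)⁻¹ * ∑ γ ∈ Γ, γ x / (∫ y, γ y ∂μ)) := by
    have := f.continuous.measurable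
    have hs : Continuous fun x => ∑ γ ∈ Γ, γ x / (∫ y, γ y ∂μ) := by fun_prop
    have := hs.measurable
    fun_prop
  rw [mlem]
  conv_lhs => rhs; rw [← withDensity_one (μ := μ)]
  rw [withDensity_eq_iff_of_sigmaFinite hm.aemeasurable measurable_one.aemeasurable]
  refine Filter.eventually_congr (.of_forall fun x => ?_)
  simp only [Pi.one_apply, Pi.zero_apply, ENNReal.ofReal_eq_one]
  rw [inv_mul_eq_one₀ (hf x).ne', sub_eq_zero]

/-- Fixed points of the ML-EM map are exactly the measures with `μ̄ ∇ℓ(μ̄) = 0`, i.e. those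
for which `∇ℓ(μ̄)` vanishes on the support of `μ̄`. -/
theorem stmt15 {K : Type*} [MetricSpace K] [CompactSpace K] [Nonempty K]
    [MeasurableSpace K] [BorelSpace K]
    (f : C(K, ℝ)) (c : ℝ) (hc : 0 < c) (hf : ∀ x : K, c ≤ f x)
    (Γ : Finset C(K, ℝ)) (hΓ : Γ.Nonempty) (hΓpos : ∀ γ ∈ Γ, ∀ x : K, 0 ≤ γ x)
    (μbar : Measure K) [IsFiniteMeasure μbar] (hdom : ∀ γ ∈ Γ, 0 < ∫ x, γ x ∂μbar) :
    (mlem f Γ μbar = μbar ↔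
      μbar.withDensityᵥ (fun x => f x - ∑ γ ∈ Γ, γ x / (∫ y, γ y ∂μbar)) = 0) ∧
    (μbar.withDensityᵥ (fun x => f x - ∑ γ ∈ Γ, γ x / (∫ y, γ y ∂μbar)) = 0 ↔
      ∀ x ∈ msupport μbar, f x - ∑ γ ∈ Γ, γ x / (∫ y, γ y ∂μbar) = 0) := by
  have hg := continuous_sub_sum_div_integral f Γ μbar
  have hv : μbar.withDensityᵥ (fun x => f x - ∑ γ ∈ Γ, γ x / (∫ y, γ y ∂μbar)) = 0 ↔
      (fun x => f x - ∑ γ ∈ Γ, γ x / (∫ y, γ y ∂μbar)) =ᵐ[μbar] 0 := by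
    rw [← withDensityᵥ_zero (μ := μbar)]
    exact (hg.integrable_of_hasCompactSupport (.of_compactSpace _)).withDensityᵥ_eq_iff
      (integrable_zero _ _ _)
  rw [hv]
  exact ⟨mlem_eq_self_iff f (fun x => hc.trans_le (hf x)) Γ μbar,
    ae_eq_zero_iff_forall_mem_msupport μbar hg⟩
end
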